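/- arXiv:1810.09094 — 4 statements merged into one kernel-verified Lean document; each statement's English description precedes it below -/
import Mathlib

section
/- Let μ be a valuation on k[X,Y] taking values in ℝ^{≤0} ∪ {+∞} with μ(X) < 0 and μ(Y) < 0, let μ0 be the monomial valuation on k[X,Y] with weights (μ(X), μ(Y)), and assume μ ≠ μ0. Let H = X^{s1} − λ·Y^{s2} be a key polynomial for μ, i.e. s1, s2 are coprime positive integers with s1·μ(X) = s2·μ(Y), λ ∈ k*, and μ(H) > μ0(H). Then for every nonzero R ∈ k[X,Y], one has μ(R) > μ0(R) if and only if H divides the (μ(X), μ(Y))-leading part R̄ of R. -/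
noncomputable section

open MvPolynomial

/-- The polynomial `q = xt - yz` in `k[x,y,z,t]` (variables `x,y,z,t` are `X 0, X 1, X 2, X 3`). -/
def qpoly (k : Type) [Field k] : MvPolynomial (Fin 4) k :=
  X 0 * X 3 - X 1 * X 2

/-- The coordinate ring `k[Q] = k[x,y,z,t]/(xt - yz - 1)` of the affine quadric threefold. -/
abbrev QuadRing (k : Type) [Field k] : Type :=
  MvPolynomial (Fin 4) k ⧸ Ideal.span {qpoly k - 1}

/-- The canonical projection `π : k[x,y,z,t] → k[Q]`. -/
def qmk (k : Type) [Field k] : MvPolynomial (Fin 4) k →+* QuadRing k :=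
  Ideal.Quotient.mk (Ideal.span {qpoly k - 1})

/-- A valuation on a commutative `k`-algebra `A`, with values in `ℝ ∪ {+∞}`:
`ν⁻¹({+∞}) = {0}`, `ν(a) = 0` for `a ∈ k*`, `ν(fg) = ν f + ν g`, and
`ν(f + g) ≥ min (ν f) (ν g)`. -/
def IsValuation (k : Type) [Field k] (A : Type) [CommRing A] [Algebra k A]
    (ν : A → WithTop ℝ) : Prop :=
  (∀ f : A, ν f = ⊤ ↔ f = 0) ∧
  (∀ a : k, a ≠ 0 → ν (algebraMap k A a) = 0) ∧
  (∀ f g : A, ν (f * g) = ν f + ν g) ∧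
  (∀ f g : A, min (ν f) (ν g) ≤ ν (f + g))

/-- The monomial valuation `ν_p^α` on `k[x,y,z,t]` at the point `p` with weights `α`:
the minimum of `⟨I, α⟩` over the exponents `I` appearing in the expansion of `R` in the
shifted variables `x - p₀, y - p₁, z - p₂, t - p₃` (and `+∞` on the zero polynomial). -/
def mvalP (k : Type) [Field k] (p : Fin 4 → k) (α : Fin 4 → ℝ)
    (R : MvPolynomial (Fin 4) k) : WithTop ℝ :=
  (MvPolynomial.aeval (fun i => X i + C (p i)) R : MvPolynomial (Fin 4) k).support.inf
    fun I => ((∑ i, α i * (I i : ℝ) : ℝ) : WithTop ℝ)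

/-- The monomial valuation `ν_0^α` on `k[x,y,z,t]` at the origin with weights `α`. -/
def mvalO (k : Type) [Field k] (α : Fin 4 → ℝ)
    (R : MvPolynomial (Fin 4) k) : WithTop ℝ :=
  R.support.inf fun I => ((∑ i, α i * (I i : ℝ) : ℝ) : WithTop ℝ)

/-- The map `ν : k[Q] → ℝ ∪ {+∞}` given by `ν(f) = sup {ν_p^α(R) : π R = f}`. -/
def nuSup (k : Type) [Field k] (p : Fin 4 → k) (α : Fin 4 → ℝ)
    (f : QuadRing k) : WithTop ℝ :=
  sSup {v : WithTop ℝ | ∃ R : MvPolynomial (Fin 4) k, qmk k R = f ∧ mvalP k p α R = v}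

/-- The set `𝒱₀` of valuations on `k[Q]` obtained from monomial valuations at points
`p ∈ k⁴` with weights `α ∈ (ℝ^{<0})⁴` satisfying `α₀ + α₃ = α₁ + α₂`. -/
def V0 (k : Type) [Field k] : Set (QuadRing k → WithTop ℝ) :=
  {ν | ∃ (p : Fin 4 → k) (α : Fin 4 → ℝ),
      (∀ i, α i < 0) ∧ α 0 + α 3 = α 1 + α 2 ∧ ν = nuSup k p α}

/-- The Jacobian determinant `Jac(R₁,R₂,R₃,R₄)` of four polynomials in `k[x,y,z,t]`. -/
def jac (k : Type) [Field k] (R : Fin 4 → MvPolynomial (Fin 4) k) :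
    MvPolynomial (Fin 4) k :=
  (Matrix.of fun i j : Fin 4 => MvPolynomial.pderiv j (R i)).det

/-- The monomial valuation on `k[X,Y]` with weights `w = (w₁, w₂)`. -/
def mval2 (k : Type) [Field k] (w : Fin 2 → ℝ)
    (R : MvPolynomial (Fin 2) k) : WithTop ℝ :=
  R.support.inf fun I => ((∑ i, w i * (I i : ℝ) : ℝ) : WithTop ℝ)

open Classical in
/-- The `(w₁,w₂)`-leading part of `R ∈ k[X,Y]`: the sum of the terms of `R` whose
weighted degree realizes the monomial valuation of `R` with weights `w`. -/
def leadPart2 (k : Type) [Field k] (w : Fin 2 → ℝ) (R : MvPolynomial (Fin 2) k) :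
    MvPolynomial (Fin 2) k :=
  ∑ I ∈ R.support.filter
      (fun I => ((∑ i, w i * (I i : ℝ) : ℝ) : WithTop ℝ) = mval2 k w R),
    monomial I (R.coeff I)

open Classical in
/-- The `α`-leading part `R^w` of `R ∈ k[x,y,z,t]` (with respect to the monomial
valuation at the origin with weights `α`). -/
def leadPart4 (k : Type) [Field k] (α : Fin 4 → ℝ) (R : MvPolynomial (Fin 4) k) :
    MvPolynomial (Fin 4) k :=
  ∑ I ∈ R.support.filter
      (fun I => ((∑ i, α i * (I i : ℝ) : ℝ) : WithTop ℝ) = mvalO k α R),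
    monomial I (R.coeff I)

/-- `(f₁, f₂)` is a component of an automorphism of `Q`: there is a `k`-algebra
automorphism `σ` of `k[Q]` with `σ x = f₁` and `σ y = f₂`. -/
def IsComponent (k : Type) [Field k] (f1 f2 : QuadRing k) : Prop :=
  ∃ σ : QuadRing k ≃ₐ[k] QuadRing k, σ (qmk k (X 0)) = f1 ∧ σ (qmk k (X 1)) = f2

/-- `(f₁, f₂)` is critically resonant with respect to `ν`. -/
def CriticallyResonant (k : Type) [Field k] (ν : QuadRing k → WithTop ℝ)
    (f1 f2 : QuadRing k) : Prop :=
  (∃ (m : ℕ) (lam : k), 1 ≤ m ∧ lam ≠ 0 ∧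
      ν f1 < ν (f1 - algebraMap k (QuadRing k) lam * f2 ^ m) ∧ ν f1 = m • ν f2) ∨
  (∃ (m : ℕ) (lam : k), 1 ≤ m ∧ lam ≠ 0 ∧
      ν f2 < ν (f2 - algebraMap k (QuadRing k) lam * f1 ^ m) ∧ ν f2 = m • ν f1)

namespace IsValuation

variable {k A : Type} [Field k] [CommRing A] [Algebra k A] {μ : A → WithTop ℝ}

theorem neg (h : IsValuation k A μ) (f : A) : μ (-f) = μ f := by
  have h1 := h.2.1 (-1) (neg_ne_zero.mpr one_ne_zero)
  have h2 := h.2.2.1 (algebraMap k A (-1)) f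
  rw [h1, zero_add] at h2
  simpa using h2

theorem lt_add (h : IsValuation k A μ) {v : WithTop ℝ} {f g : A} (hf : v < μ f) (hg : v < μ g) :
    v < μ (f + g) :=
  (lt_min hf hg).trans_le (h.2.2.2 f g)

theorem lt_sum (h : IsValuation k A μ) {ι : Type*} (s : Finset ι) (f : ι → A) (v : ℝ)
    (hf : ∀ i ∈ s, (v : WithTop ℝ) < μ (f i)) : (v : WithTop ℝ) < μ (∑ i ∈ s, f i) := by
  refine Finset.sum_induction f (fun x => (v : WithTop ℝ) < μ x) (fun _ _ => h.lt_add) ?_ hf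
  rw [(h.1 0).mpr rfl]
  exact WithTop.coe_lt_top v

theorem lt_add_iff (h : IsValuation k A μ) {v : WithTop ℝ} {f : A} (hf : v < μ f) (g : A) :
    v < μ (f + g) ↔ v < μ g := by
  refine ⟨fun hfg => ?_, h.lt_add hf⟩
  have := h.lt_add (show v < μ (-f) by rwa [h.neg]) hfg
  rwa [neg_add_cancel_left] at this

theorem one (h : IsValuation k A μ) : μ 1 = 0 := by
  simpa using h.2.1 1 one_ne_zero

theorem pow (h : IsValuation k A μ) {f : A} {a : ℝ} (hf : μ f = (a : WithTop ℝ)) (n : ℕ) :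
    μ (f ^ n) = ((a * n : ℝ) : WithTop ℝ) := by
  induction n with
  | zero => simp [h.one]
  | succ n ih =>
    rw [pow_succ, h.2.2.1, ih, hf, ← WithTop.coe_add]
    congr 1
    push_cast
    ring

end IsValuation

section TwoVariables

variable {k : Type} [Field k] {μ : MvPolynomial (Fin 2) k → WithTop ℝ} {a b : ℝ}

theorem IsValuation.apply_term (h : IsValuation k (MvPolynomial (Fin 2) k) μ)
    (ha : μ (X 0) = (a : WithTop ℝ)) (hb : μ (X 1) = (b : WithTop ℝ))
    {r : k} (hr : r ≠ 0) (i j : ℕ) :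
    μ (C r * X 0 ^ i * X 1 ^ j) = ((a * i + b * j : ℝ) : WithTop ℝ) := by
  rw [h.2.2.1, h.2.2.1, h.pow ha, h.pow hb, ← algebraMap_eq, h.2.1 r hr, zero_add,
    ← WithTop.coe_add]

/-- A homogeneous binomial lying in the ideal of the key polynomial has value larger than
its weight. -/
theorem key_dvd_and_lt_of_binomial (h : IsValuation k (MvPolynomial (Fin 2) k) μ)
    (ha : μ (X 0) = (a : WithTop ℝ)) (hb : μ (X 1) = (b : WithTop ℝ))
    {s1 s2 : ℕ} (hw : (s1 : ℝ) * a = (s2 : ℝ) * b) {lam : k} (hlam : lam ≠ 0)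
    (hkey : ((s1 * a : ℝ) : WithTop ℝ) < μ (X 0 ^ s1 - C lam * X 1 ^ s2)) (i n : ℕ) (v : ℝ) :
    ∀ (j : ℕ) (r : k), r ≠ 0 → a * (i + s1 * n : ℕ) + b * j = v →
      (X 0 ^ s1 - C lam * X 1 ^ s2) ∣
        (C r * X 0 ^ (i + s1 * n) * X 1 ^ j - C (r * lam ^ n) * X 0 ^ i * X 1 ^ (j + s2 * n) :
          MvPolynomial (Fin 2) k) ∧
      (v : WithTop ℝ) <
        μ (C r * X 0 ^ (i + s1 * n) * X 1 ^ j
          - C (r * lam ^ n) * X 0 ^ i * X 1 ^ (j + s2 * n)) := by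
  induction n with
  | zero =>
    intro j r _ _
    simp [(h.1 0).mpr rfl]
  | succ n ih =>
    intro j r hr hv
    obtain ⟨hd, hl⟩ := ih (j + s2) (r * lam) (mul_ne_zero hr hlam) (by
      rw [← hv]; push_cast; linear_combination -hw)
    have e : (C r * X 0 ^ (i + s1 * (n + 1)) * X 1 ^ j
          - C (r * lam ^ (n + 1)) * X 0 ^ i * X 1 ^ (j + s2 * (n + 1)) :
            MvPolynomial (Fin 2) k)
        = (X 0 ^ s1 - C lam * X 1 ^ s2) * (C r * X 0 ^ (i + s1 * n) * X 1 ^ j)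
          + (C (r * lam) * X 0 ^ (i + s1 * n) * X 1 ^ (j + s2)
            - C (r * lam * lam ^ n) * X 0 ^ i * X 1 ^ (j + s2 + s2 * n)) := by
      simp only [C_mul, C_pow]
      ring
    rw [e]
    refine ⟨dvd_add (dvd_mul_right _ _) hd, h.lt_add ?_ hl⟩
    rw [h.2.2.1, h.apply_term ha hb hr]
    have hv' : (v : WithTop ℝ)
        = ((s1 * a : ℝ) : WithTop ℝ) + ((a * (i + s1 * n : ℕ) + b * j : ℝ) : WithTop ℝ) := by
      rw [← WithTop.coe_add, ← hv]
      congr 1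
      push_cast
      ring
    rw [hv']
    exact WithTop.add_lt_add_right WithTop.coe_ne_top hkey

theorem weight_le_mval2_key {s1 s2 : ℕ} (hw : (s1 : ℝ) * a = (s2 : ℝ) * b) (lam : k) :
    ((s1 * a : ℝ) : WithTop ℝ) ≤ mval2 k ![a, b] (X 0 ^ s1 - C lam * X 1 ^ s2) := by
  refine Finset.le_inf fun I hI => ?_
  rw [WithTop.coe_le_coe]
  rw [mem_support_iff, coeff_sub, coeff_C_mul, coeff_X_pow, coeff_X_pow] at hI
  by_cases h0 : Finsupp.single 0 s1 = I
  · subst h0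
    simp [mul_comm]
  · by_cases h1 : Finsupp.single 1 s2 = I
    · subst h1
      simp [hw, mul_comm]
    · simp [h0, h1] at hI

/-- The key polynomial has a zero on the torus, hence divides no nonzero term. -/
theorem key_dvd_term_iff [IsAlgClosed k] {s1 : ℕ} (hs1 : 0 < s1) (s2 : ℕ) {lam : k}
    (hlam : lam ≠ 0) (c : k) (i j : ℕ) :
    (X 0 ^ s1 - C lam * X 1 ^ s2) ∣ (C c * X 0 ^ i * X 1 ^ j : MvPolynomial (Fin 2) k) ↔
      c = 0 := by
  refine ⟨fun ⟨g, hg⟩ => ?_, fun hc => by simp [hc]⟩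
  obtain ⟨x, hx⟩ := IsAlgClosed.exists_pow_nat_eq lam hs1
  have hx0 : x ≠ 0 := by
    rintro rfl
    exact hlam (by rw [← hx, zero_pow hs1.ne'])
  have := congrArg (eval ![x, 1]) hg
  simpa [hx, hx0] using this

/-- Two exponents of the same weight differ by a multiple of `(s1, -s2)`. -/
theorem exists_exponent_shift (ha0 : a < 0) {s1 s2 : ℕ} (hs1 : 0 < s1)
    (hcop : Nat.Coprime s1 s2) (hw : (s1 : ℝ) * a = (s2 : ℝ) * b) {i j i' j' : ℕ}
    (hle : i ≤ i') (hwt : a * i' + b * j' = a * i + b * j) :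
    ∃ n, i' = i + s1 * n ∧ j = j' + s2 * n := by
  obtain ⟨d, rfl⟩ := Nat.exists_eq_add_of_le hle
  have hnat : s2 * d + s1 * j' = s1 * j := by
    have : a * ((s2 * d + s1 * j' : ℕ) : ℝ) = a * ((s1 * j : ℕ) : ℝ) := by
      push_cast at hwt ⊢
      linear_combination s2 * hwt + (j' - j : ℝ) * hw
    exact_mod_cast mul_left_cancel₀ ha0.ne this
  have hdvd : s1 ∣ s2 * d := (Nat.dvd_add_left (dvd_mul_right s1 j')).mp ⟨j, hnat⟩
  obtain ⟨n, rfl⟩ := hcop.dvd_of_dvd_mul_left hdvd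
  refine ⟨n, rfl, Nat.eq_of_mul_eq_mul_left hs1 ?_⟩
  rw [← hnat]
  ring

end TwoVariables

/-- Proposition 4.13 (iii): let `μ` be a valuation on `k[X,Y]` with
values in `ℝ^{≤0} ∪ {+∞}`, `μ(X) = a < 0`, `μ(Y) = b < 0`, `μ ≠ μ₀` (the monomial
valuation with weights `(a,b)`), and let `H = X^{s₁} - λ·Y^{s₂}` be a key polynomial for
`μ` (`s₁, s₂` coprime positive, `s₁·a = s₂·b`, `λ ≠ 0`, `μ(H) > μ₀(H)`). Then for every
nonzero `R`, `μ(R) > μ₀(R)` if and only if `H` divides the `(a,b)`-leading part of `R`. -/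
theorem val_gt_monomialVal_iff_key_dvd (k : Type) [Field k] [IsAlgClosed k] [CharZero k]
    (μ : MvPolynomial (Fin 2) k → WithTop ℝ)
    (hval : IsValuation k (MvPolynomial (Fin 2) k) μ)
    (hneg : ∀ R : MvPolynomial (Fin 2) k, μ R ≤ 0 ∨ μ R = ⊤)
    (a b : ℝ) (ha : μ (X 0) = (a : WithTop ℝ)) (hb : μ (X 1) = (b : WithTop ℝ))
    (ha0 : a < 0) (hb0 : b < 0)
    (hne : μ ≠ mval2 k ![a, b])
    (s1 s2 : ℕ) (hs1 : 0 < s1) (hs2 : 0 < s2) (hcop : Nat.Coprime s1 s2)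
    (hw : (s1 : ℝ) * a = (s2 : ℝ) * b)
    (lam : k) (hlam : lam ≠ 0)
    (hkey : mval2 k ![a, b] (X 0 ^ s1 - C lam * X 1 ^ s2)
        < μ (X 0 ^ s1 - C lam * X 1 ^ s2)) :
    ∀ R : MvPolynomial (Fin 2) k, R ≠ 0 →
      (mval2 k ![a, b] R < μ R ↔
        (X 0 ^ s1 - C lam * X 1 ^ s2) ∣ leadPart2 k ![a, b] R) := by
  classical
  intro R hR
  set H : MvPolynomial (Fin 2) k := X 0 ^ s1 - C lam * X 1 ^ s2 with hH
  have hkey' : ((s1 * a : ℝ) : WithTop ℝ) < μ H :=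
    (weight_le_mval2_key hw lam).trans_lt hkey
  set wt : (Fin 2 →₀ ℕ) → WithTop ℝ :=
    fun I => ((∑ i, ![a, b] i * (I i : ℝ) : ℝ) : WithTop ℝ) with hwt
  have wt_eq (I : Fin 2 →₀ ℕ) : wt I = ((a * I 0 + b * I 1 : ℝ) : WithTop ℝ) := by
    simp [hwt, Fin.sum_univ_two]
  have hmon (I : Fin 2 →₀ ℕ) (r : k) (hr : r ≠ 0) : μ (monomial I r) = wt I := by
    rw [monomial_fin_two, hval.apply_term ha hb hr, wt_eq]
  obtain ⟨I₁, hI₁, hmin⟩ :=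
    Finset.exists_mem_eq_inf R.support (support_nonempty.mpr hR) wt
  have hm : mval2 k ![a, b] R = wt I₁ := hmin
  set S := R.support.filter (fun I => wt I = mval2 k ![a, b] R) with hS
  obtain ⟨I₀, hI₀, hI₀min⟩ := Finset.exists_min_image S (fun I => I 0)
    ⟨I₁, Finset.mem_filter.mpr ⟨hI₁, hm.symm⟩⟩
  have hL : leadPart2 k ![a, b] R = ∑ I ∈ S, monomial I (R.coeff I) := rfl
  set v : ℝ := a * I₀ 0 + b * I₀ 1 with hv
  have hmv : mval2 k ![a, b] R = (v : WithTop ℝ) := by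
    rw [← (Finset.mem_filter.mp hI₀).2, wt_eq]
  have hRsplit : (∑ I ∈ R.support.filter (fun I => ¬ wt I = mval2 k ![a, b] R),
      monomial I (R.coeff I)) + leadPart2 k ![a, b] R = R := by
    rw [hL, add_comm, hS, Finset.sum_filter_add_sum_filter_not, support_sum_monomial_coeff]
  have hT : (v : WithTop ℝ) <
      μ (∑ I ∈ R.support.filter (fun I => ¬ wt I = mval2 k ![a, b] R),
        monomial I (R.coeff I)) := by
    refine hval.lt_sum _ _ _ fun I hI => ?_
    obtain ⟨hI, hne⟩ := Finset.mem_filter.mp hI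
    rw [hmon I _ (mem_support_iff.mp hI), ← hmv]
    exact lt_of_le_of_ne (Finset.inf_le hI) (Ne.symm hne)
  have hshift : ∀ I ∈ S, ∃ c : k,
      H ∣ (monomial I (R.coeff I) - C c * X 0 ^ I₀ 0 * X 1 ^ I₀ 1) ∧
      (v : WithTop ℝ) < μ (monomial I (R.coeff I) - C c * X 0 ^ I₀ 0 * X 1 ^ I₀ 1) := by
    intro I hI
    obtain ⟨hIs, hIw⟩ := Finset.mem_filter.mp hI
    rw [wt_eq, hmv, WithTop.coe_inj] at hIw
    obtain ⟨n, h0, h1⟩ := exists_exponent_shift ha0 hs1 hcop hw (hI₀min I hI) hIw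
    refine ⟨R.coeff I * lam ^ n, ?_⟩
    rw [monomial_fin_two, h0, h1]
    refine key_dvd_and_lt_of_binomial hval ha hb hw hlam hkey' _ n v _ _
      (mem_support_iff.mp hIs) ?_
    rw [← h0, hIw]
  choose! c hcd hcl using hshift
  set E : MvPolynomial (Fin 2) k :=
    ∑ I ∈ S, (monomial I (R.coeff I) - C (c I) * X 0 ^ I₀ 0 * X 1 ^ I₀ 1) with hE
  have hLE : leadPart2 k ![a, b] R
      = E + C (∑ I ∈ S, c I) * X 0 ^ I₀ 0 * X 1 ^ I₀ 1 := by
    rw [hE, Finset.sum_sub_distrib, ← hL, map_sum, Finset.sum_mul, Finset.sum_mul,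
      sub_add_cancel]
  have hEd : H ∣ E := Finset.dvd_sum hcd
  have hEl : (v : WithTop ℝ) < μ E := hval.lt_sum _ _ _ hcl
  conv_lhs => rw [hmv, ← hRsplit]
  rw [hval.lt_add_iff hT, hLE, hval.lt_add_iff hEl, dvd_add_right hEd,
    key_dvd_term_iff hs1 s2 hlam]
  constructor
  · intro hlt
    by_contra hc
    rw [hval.apply_term ha hb hc] at hlt
    exact hlt.ne rfl
  · intro hc
    rw [hc, C_0, zero_mul, zero_mul, (hval.1 0).mpr rfl]
    exact WithTop.coe_lt_top v
end
end

section
/- Let (α,β) be real weights with α < 0 and β < 0, let s1, s2 be coprime positive integers with s1·α = s2·β, let λ ∈ k*, and set H := X^{s1} − λ·Y^{s2}. Let R ∈ k[X,Y] be nonzero, let R̄ be its (α,β)-leading part, assume H divides R̄, and let n := max{m ∈ ℕ : H^m divides R̄} (so n ≥ 1). Then for every integer m with 0 ≤ m ≤ n, the (α,β)-leading part of ∂_Y^m R equals ∂_Y^m (R̄). -/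
noncomputable section

open MvPolynomial

section LeadingPart

variable {k : Type} [Field k] {w : Fin 2 → ℝ}

theorem coeff_leadPart2 (w : Fin 2 → ℝ) (R : MvPolynomial (Fin 2) k) (I : Fin 2 →₀ ℕ)
    [Decidable (((∑ i, w i * (I i : ℝ) : ℝ) : WithTop ℝ) = mval2 k w R)] :
    (leadPart2 k w R).coeff I =
      if ((∑ i, w i * (I i : ℝ) : ℝ) : WithTop ℝ) = mval2 k w R then R.coeff I else 0 := by
  classical
  simp only [leadPart2, coeff_sum, coeff_monomial, Finset.sum_ite_eq', Finset.mem_filter,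
    mem_support_iff]
  by_cases h : R.coeff I = 0 <;> simp [h]

theorem mem_support_leadPart2 {R : MvPolynomial (Fin 2) k} {I : Fin 2 →₀ ℕ} :
    I ∈ (leadPart2 k w R).support ↔
      I ∈ R.support ∧ ((∑ i, w i * (I i : ℝ) : ℝ) : WithTop ℝ) = mval2 k w R := by
  classical
  simp [coeff_leadPart2, and_comm]

theorem mval2_le {R : MvPolynomial (Fin 2) k} {I : Fin 2 →₀ ℕ} (hI : I ∈ R.support) :
    mval2 k w R ≤ ((∑ i, w i * (I i : ℝ) : ℝ) : WithTop ℝ) :=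
  Finset.inf_le (f := fun I : Fin 2 →₀ ℕ => ((∑ i, w i * (I i : ℝ) : ℝ) : WithTop ℝ)) hI

theorem sum_weight_add_single (w : Fin 2 → ℝ) (I : Fin 2 →₀ ℕ) (j : Fin 2) :
    ∑ i, w i * ((I + Finsupp.single j 1 : Fin 2 →₀ ℕ) i : ℝ) = ∑ i, w i * (I i : ℝ) + w j := by
  simp [mul_add, Finset.sum_add_distrib, Finsupp.single_apply, -Fin.sum_univ_two]

theorem mem_support_pderiv [CharZero k] {R : MvPolynomial (Fin 2) k} {j : Fin 2}
    {I : Fin 2 →₀ ℕ} :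
    I ∈ (pderiv j R).support ↔ I + Finsupp.single j 1 ∈ R.support := by
  simp [coeff_pderiv, Nat.cast_add_one_ne_zero]

/-- Taking the leading part commutes with `∂_j` as soon as `∂_j` does not kill the leading part. -/
theorem leadPart2_pderiv [CharZero k] {R : MvPolynomial (Fin 2) k} {j : Fin 2}
    (h : pderiv j (leadPart2 k w R) ≠ 0) :
    leadPart2 k w (pderiv j R) = pderiv j (leadPart2 k w R) := by
  classical
  obtain ⟨I, hI⟩ := support_nonempty.mpr h
  rw [mem_support_pderiv, mem_support_leadPart2, sum_weight_add_single] at hI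
  obtain ⟨hIR, hIw⟩ := hI
  have hval : mval2 k w (pderiv j R) = ((∑ i, w i * (I i : ℝ) : ℝ) : WithTop ℝ) := by
    refine le_antisymm (mval2_le (mem_support_pderiv.mpr hIR)) (Finset.le_inf fun J hJ => ?_)
    have hle := mval2_le (w := w) (mem_support_pderiv.mp hJ)
    rw [← hIw, sum_weight_add_single, WithTop.coe_le_coe] at hle
    exact WithTop.coe_le_coe.mpr (le_of_add_le_add_right hle)
  ext J
  simp only [coeff_pderiv, coeff_leadPart2, hval, ← hIw, sum_weight_add_single, WithTop.coe_inj,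
    add_left_inj, ite_mul, zero_mul]

theorem leadPart2_iterate_pderiv [CharZero k] {j : Fin 2} {m : ℕ} {R : MvPolynomial (Fin 2) k}
    {I : Fin 2 →₀ ℕ} (hI : I ∈ (leadPart2 k w R).support) (hm : m ≤ I j) :
    leadPart2 k w ((fun S : MvPolynomial (Fin 2) k => pderiv j S)^[m] R)
      = (fun S : MvPolynomial (Fin 2) k => pderiv j S)^[m] (leadPart2 k w R) := by
  induction m generalizing R I with
  | zero => rfl
  | succ m ih =>
    have hle : Finsupp.single j 1 ≤ I := Finsupp.single_le_iff.mpr (by lia)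
    have hI' : I - Finsupp.single j 1 ∈ (pderiv j (leadPart2 k w R)).support := by
      rwa [mem_support_pderiv, tsub_add_cancel_of_le hle]
    have hcomm := leadPart2_pderiv (support_nonempty.mp ⟨_, hI'⟩)
    rw [Function.iterate_succ_apply, Function.iterate_succ_apply, ← hcomm]
    refine ih (hcomm ▸ hI') ?_
    simp only [Finsupp.tsub_apply, Finsupp.single_eq_same]
    lia

end LeadingPart

theorem degreeOf_one_binomial_pos {k : Type} [Field k] {s1 s2 : ℕ} (hs1 : 0 < s1) (hs2 : 0 < s2)
    {lam : k} (hlam : lam ≠ 0) :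
    0 < degreeOf 1 (X 0 ^ s1 - C lam * X 1 ^ s2 : MvPolynomial (Fin 2) k) := by
  have hmem : Finsupp.single 1 s2 ∈
      (X 0 ^ s1 - C lam * X 1 ^ s2 : MvPolynomial (Fin 2) k).support := by
    have hne : Finsupp.single (0 : Fin 2) s1 ≠ Finsupp.single 1 s2 := fun h => by
      simpa [hs1.ne'] using DFunLike.congr_fun h 0
    simp [coeff_X_pow, coeff_C_mul, hne, hlam]
  have hle := monomial_le_degreeOf 1 hmem
  rw [Finsupp.single_eq_same] at hle
  lia

/-- Lemma 4.21 (i): with weights `α, β < 0`, coprime positive integers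
`s₁, s₂` satisfying `s₁·α = s₂·β`, `λ ∈ k*`, and `H = X^{s₁} - λ·Y^{s₂}`, if `R ≠ 0`,
`H` divides the `(α,β)`-leading part `R̄` of `R` and `n` is the largest integer with
`H^n ∣ R̄`, then for every `0 ≤ m ≤ n` the `(α,β)`-leading part of `∂_Y^m R` equals
`∂_Y^m (R̄)`. -/
theorem leadPart_pderiv_eq (k : Type) [Field k] [IsAlgClosed k] [CharZero k]
    (α β : ℝ) (hα : α < 0) (hβ : β < 0)
    (s1 s2 : ℕ) (hs1 : 0 < s1) (hs2 : 0 < s2) (hcop : Nat.Coprime s1 s2)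
    (hw : (s1 : ℝ) * α = (s2 : ℝ) * β)
    (lam : k) (hlam : lam ≠ 0)
    (R : MvPolynomial (Fin 2) k) (hR : R ≠ 0)
    (hdvd : (X 0 ^ s1 - C lam * X 1 ^ s2) ∣ leadPart2 k ![α, β] R)
    (n : ℕ)
    (hn : (X 0 ^ s1 - C lam * X 1 ^ s2) ^ n ∣ leadPart2 k ![α, β] R)
    (hn' : ¬ (X 0 ^ s1 - C lam * X 1 ^ s2) ^ (n + 1) ∣ leadPart2 k ![α, β] R) :
    ∀ m : ℕ, m ≤ n →
      leadPart2 k ![α, β] ((fun S : MvPolynomial (Fin 2) k => pderiv (1 : Fin 2) S)^[m] R)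
        = (fun S : MvPolynomial (Fin 2) k => pderiv (1 : Fin 2) S)^[m]
            (leadPart2 k ![α, β] R) := by
  intro m hm
  have hne : leadPart2 k ![α, β] R ≠ 0 := fun h => hn' (h ▸ dvd_zero _)
  have hdeg : n ≤ degreeOf 1 (leadPart2 k ![α, β] R) := by
    obtain ⟨G, hG⟩ := hn
    have hpos := degreeOf_one_binomial_pos hs1 hs2 hlam
    have hH : (X 0 ^ s1 - C lam * X 1 ^ s2 : MvPolynomial (Fin 2) k) ≠ 0 := fun h => by
      simp [h] at hpos
    rw [hG] at hne ⊢
    rw [degreeOf_mul_eq (left_ne_zero_of_mul hne) (right_ne_zero_of_mul hne),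
      degreeOf_pow_eq _ _ _ hH]
    exact (Nat.le_mul_of_pos_right n hpos).trans (Nat.le_add_right _ _)
  obtain ⟨I, hI, hImax⟩ := Finset.exists_mem_eq_sup _ (support_nonempty.mpr hne)
    fun I : Fin 2 →₀ ℕ => I 1
  rw [degreeOf_eq_sup, hImax] at hdeg
  exact leadPart2_iterate_pderiv hI (hm.trans hdeg)
end
end

section
/- Let (α,β) be real weights with α < 0 and β < 0, let s1, s2 be coprime positive integers with s1·α = s2·β, let λ ∈ k*, and set H := X^{s1} − λ·Y^{s2}. Let R ∈ k[X,Y] be nonzero, let R̄ be its (α,β)-leading part, assume H divides R̄, and let n := max{m ∈ ℕ : H^m divides R̄} (so n ≥ 1). Then for every integer m with 0 ≤ m ≤ n, H^{n−m} divides ∂_Y^m (R̄) but H^{n−m+1} does not divide ∂_Y^m (R̄). -/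
noncomputable section

open MvPolynomial

open scoped Polynomial in
/-- The parametrization `X ↦ μ T ^ s₂`, `Y ↦ T ^ s₁` of the curve `X ^ s₁ = μ ^ s₁ Y ^ s₂`. -/
def binomialParam (k : Type) [Field k] (s1 s2 : ℕ) (μ : k) :
    MvPolynomial (Fin 2) k →ₐ[k] k[X] :=
  aeval ![Polynomial.C μ * Polynomial.X ^ s2, Polynomial.X ^ s1]

theorem binomialParam_monomial (k : Type) [Field k] (s1 s2 : ℕ) (μ : k)
    (I : Fin 2 →₀ ℕ) (c : k) :
    binomialParam k s1 s2 μ (monomial I c) =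
      Polynomial.monomial (s2 * I 0 + s1 * I 1) (c * μ ^ I 0) := by
  rw [binomialParam, aeval_monomial, Finsupp.prod_fintype _ _ (by simp)]
  simp only [Fin.prod_univ_two, Matrix.cons_val_zero, Matrix.cons_val_one,
    ← Polynomial.C_mul_X_pow_eq_monomial, Polynomial.algebraMap_eq, map_mul, map_pow, mul_pow,
    pow_add, pow_mul]
  ring

theorem weight_injective_of_lt {s1 s2 a b c d : ℕ} (hs1 : 0 < s1) (hcop : Nat.Coprime s1 s2)
    (ha : a < s1) (hc : c < s1) (h : s2 * a + s1 * b = s2 * c + s1 * d) : a = c ∧ b = d := by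
  have hmod : s2 * a ≡ s2 * c [MOD s1] := by
    have := congrArg (· % s1) h
    simpa [Nat.ModEq] using this
  have hac : a = c :=
    (Nat.ModEq.cancel_left_of_coprime hcop hmod).eq_of_lt_of_lt ha hc
  subst hac
  exact ⟨rfl, Nat.eq_of_mul_eq_mul_left hs1 (by omega)⟩

theorem eq_zero_of_binomialParam_eq_zero (k : Type) [Field k] {s1 s2 : ℕ} (hs1 : 0 < s1)
    (hcop : Nat.Coprime s1 s2) {μ : k} (hμ : μ ≠ 0) {S : MvPolynomial (Fin 2) k}
    (hS : ∀ I ∈ S.support, I 0 < s1) (h : binomialParam k s1 s2 μ S = 0) : S = 0 := by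
  by_contra hne
  obtain ⟨J, hJ⟩ := support_nonempty.mpr hne
  have hcoeff := congrArg (fun p => p.coeff (s2 * J 0 + s1 * J 1)) h
  rw [S.as_sum, map_sum] at hcoeff
  simp only [binomialParam_monomial, Polynomial.finsetSum_coeff, Polynomial.coeff_monomial,
    Polynomial.coeff_zero] at hcoeff
  rw [Finset.sum_eq_single_of_mem J hJ] at hcoeff
  · rw [if_pos rfl] at hcoeff
    exact mul_ne_zero (mem_support_iff.mp hJ) (pow_ne_zero _ hμ) hcoeff
  · intro I hI hIJ
    refine if_neg fun heq => hIJ ?_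
    obtain ⟨h0, h1⟩ := weight_injective_of_lt hs1 hcop (hS I hI) (hS J hJ) heq
    ext i
    fin_cases i
    · exact h0
    · exact h1

/-- Division with remainder by `X ^ s₁ - λ Y ^ s₂` with respect to `X`. -/
theorem exists_eq_binomial_mul_add (k : Type) [Field k] {s1 : ℕ} (s2 : ℕ) (hs1 : 0 < s1) (lam : k)
    (P : MvPolynomial (Fin 2) k) :
    ∃ Q S : MvPolynomial (Fin 2) k,
      P = (X 0 ^ s1 - C lam * X 1 ^ s2) * Q + S ∧ ∀ I ∈ S.support, I 0 < s1 := by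
  have key : ∀ i j : ℕ, ∀ c : k, ∃ Q S : MvPolynomial (Fin 2) k,
      C c * X 0 ^ i * X 1 ^ j = (X 0 ^ s1 - C lam * X 1 ^ s2) * Q + S ∧
        ∀ I ∈ S.support, I 0 < s1 := by
    intro i
    induction i using Nat.strong_induction_on with
    | _ i ih =>
      intro j c
      rcases lt_or_ge i s1 with hi | hi
      · refine ⟨0, C c * X 0 ^ i * X 1 ^ j, by ring, fun I hI => ?_⟩
        have hmon : (C c * X 0 ^ i * X 1 ^ j : MvPolynomial (Fin 2) k) =
            monomial (Finsupp.single 0 i + Finsupp.single 1 j) c := by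
          rw [X_pow_eq_monomial, X_pow_eq_monomial, C_mul_monomial, monomial_mul]
          simp
        rw [hmon] at hI
        rw [Finset.mem_singleton.mp (support_monomial_subset hI)]
        simpa using hi
      · obtain ⟨Q, S, hQS, hS⟩ := ih (i - s1) (by omega) (j + s2) (c * lam)
        refine ⟨C c * X 0 ^ (i - s1) * X 1 ^ j + Q, S, ?_, hS⟩
        rw [mul_add, add_assoc, ← hQS, C_mul]
        obtain ⟨d, rfl⟩ := Nat.exists_eq_add_of_le hi
        rw [Nat.add_sub_cancel_left]
        ring
  induction P using MvPolynomial.induction_on' with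
  | monomial I c =>
    obtain ⟨Q, S, hQS, hS⟩ := key (I 0) (I 1) c
    refine ⟨Q, S, ?_, hS⟩
    rw [← hQS, monomial_eq, Finsupp.prod_fintype _ _ (by simp), Fin.prod_univ_two, mul_assoc]
  | add p q hp hq =>
    obtain ⟨Q, S, hp, hS⟩ := hp
    obtain ⟨Q', S', hq, hS'⟩ := hq
    refine ⟨Q + Q', S + S', by rw [hp, hq]; ring, fun I hI => ?_⟩
    classical
    rcases Finset.mem_union.mp (support_add hI) with h | h
    · exact hS I h
    · exact hS' I h

theorem binomial_dvd_iff (k : Type) [Field k] {s1 s2 : ℕ} (hs1 : 0 < s1)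
    (hcop : Nat.Coprime s1 s2) {μ : k} (hμ : μ ≠ 0) (P : MvPolynomial (Fin 2) k) :
    (X 0 ^ s1 - C (μ ^ s1) * X 1 ^ s2) ∣ P ↔ binomialParam k s1 s2 μ P = 0 := by
  have hH : binomialParam k s1 s2 μ (X 0 ^ s1 - C (μ ^ s1) * X 1 ^ s2) = 0 := by
    simp only [binomialParam, map_sub, map_mul, map_pow, aeval_X, Matrix.cons_val_zero,
      Matrix.cons_val_one, algHom_C, Polynomial.algebraMap_eq]
    ring
  constructor
  · rintro ⟨Q, rfl⟩
    rw [map_mul, hH, zero_mul]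
  · intro hP
    obtain ⟨Q, S, rfl, hS⟩ := exists_eq_binomial_mul_add k s2 hs1 (μ ^ s1) P
    rw [map_add, map_mul, hH, zero_mul, zero_add] at hP
    rw [eq_zero_of_binomialParam_eq_zero k hs1 hcop hμ hS hP, add_zero]
    exact dvd_mul_right _ _

/-- A derivation `D` lowers by one the multiplicity of a prime `p` with `p ∤ D p`. -/
theorem Derivation.pow_dvd_and_not_pow_succ_dvd {k A : Type*} [Field k] [CharZero k] [CommRing A]
    [IsDomain A] [Algebra k A] (D : Derivation k A A) {p : A} (hp : p ≠ 0)
    (hprime : ∀ a b, p ∣ a * b → p ∣ a ∨ p ∣ b) (hD : ¬ p ∣ D p) {n : ℕ} {a : A}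
    (ha : p ^ (n + 1) ∣ a) (ha' : ¬ p ^ (n + 2) ∣ a) : p ^ n ∣ D a ∧ ¬ p ^ (n + 1) ∣ D a := by
  obtain ⟨q, rfl⟩ := ha
  have hDa : D (p ^ (n + 1) * q) = p ^ n * (p * D q + ((n + 1 : ℕ) : A) * (q * D p)) := by
    rw [D.leibniz, D.leibniz_pow]
    simp only [smul_eq_mul, nsmul_eq_mul, Nat.add_sub_cancel]
    ring
  rw [hDa]
  refine ⟨dvd_mul_right _ _, fun h => ?_⟩
  rw [pow_succ, mul_dvd_mul_iff_left (pow_ne_zero n hp), dvd_add_right (dvd_mul_right _ _)] at h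
  have hunit : IsUnit ((n + 1 : ℕ) : A) := by
    rw [← _root_.map_natCast (algebraMap k A)]
    exact (IsUnit.mk0 _ (Nat.cast_ne_zero.mpr n.succ_ne_zero)).map _
  rw [hunit.dvd_mul_left] at h
  rcases hprime _ _ h with h | h
  · exact ha' (by rw [pow_succ p (n + 1)]; exact mul_dvd_mul_left _ h)
  · exact hD h

/-- Lemma 4.21 (ii): with weights `α, β < 0`, coprime positive integers
`s₁, s₂` satisfying `s₁·α = s₂·β`, `λ ∈ k*`, and `H = X^{s₁} - λ·Y^{s₂}`, if `R ≠ 0`,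
`H` divides the `(α,β)`-leading part `R̄` of `R` and `n` is the largest integer with
`H^n ∣ R̄`, then for every `0 ≤ m ≤ n` one has `H^{n-m} ∣ ∂_Y^m (R̄)` but
`H^{n-m+1} ∤ ∂_Y^m (R̄)`. -/
theorem key_pow_dvd_pderiv_leadPart (k : Type) [Field k] [IsAlgClosed k] [CharZero k]
    (α β : ℝ) (hα : α < 0) (hβ : β < 0)
    (s1 s2 : ℕ) (hs1 : 0 < s1) (hs2 : 0 < s2) (hcop : Nat.Coprime s1 s2)
    (hw : (s1 : ℝ) * α = (s2 : ℝ) * β)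
    (lam : k) (hlam : lam ≠ 0)
    (R : MvPolynomial (Fin 2) k) (hR : R ≠ 0)
    (hdvd : (X 0 ^ s1 - C lam * X 1 ^ s2) ∣ leadPart2 k ![α, β] R)
    (n : ℕ)
    (hn : (X 0 ^ s1 - C lam * X 1 ^ s2) ^ n ∣ leadPart2 k ![α, β] R)
    (hn' : ¬ (X 0 ^ s1 - C lam * X 1 ^ s2) ^ (n + 1) ∣ leadPart2 k ![α, β] R) :
    ∀ m : ℕ, m ≤ n →
      ((X 0 ^ s1 - C lam * X 1 ^ s2) ^ (n - m) ∣
          (fun S : MvPolynomial (Fin 2) k => pderiv (1 : Fin 2) S)^[m]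
            (leadPart2 k ![α, β] R)) ∧
      ¬ ((X 0 ^ s1 - C lam * X 1 ^ s2) ^ (n - m + 1) ∣
          (fun S : MvPolynomial (Fin 2) k => pderiv (1 : Fin 2) S)^[m]
            (leadPart2 k ![α, β] R)) := by
  obtain ⟨μ, rfl⟩ := IsAlgClosed.exists_pow_nat_eq lam hs1
  have hμ : μ ≠ 0 := by
    rintro rfl
    exact hlam (zero_pow hs1.ne')
  have hiff := binomial_dvd_iff k hs1 hcop hμ
  have hpd : pderiv (1 : Fin 2) (X 0 ^ s1 - C (μ ^ s1) * X 1 ^ s2 : MvPolynomial (Fin 2) k) =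
      monomial (Finsupp.single 1 (s2 - 1)) (-(μ ^ s1 * s2)) := by
    rw [X_pow_eq_monomial, X_pow_eq_monomial, C_mul_monomial, map_sub, pderiv_monomial,
      pderiv_monomial]
    simp [← Finsupp.single_tsub]
  have hD : ¬ (X 0 ^ s1 - C (μ ^ s1) * X 1 ^ s2 : MvPolynomial (Fin 2) k) ∣
      pderiv (1 : Fin 2) (X 0 ^ s1 - C (μ ^ s1) * X 1 ^ s2) := by
    rw [hiff, hpd, binomialParam_monomial, Polynomial.monomial_eq_zero_iff]
    exact mul_ne_zero (neg_ne_zero.mpr (mul_ne_zero hlam (Nat.cast_ne_zero.mpr hs2.ne')))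
      (pow_ne_zero _ hμ)
  have hH : (X 0 ^ s1 - C (μ ^ s1) * X 1 ^ s2 : MvPolynomial (Fin 2) k) ≠ 0 := by
    intro h
    rw [h, map_zero] at hD
    exact hD dvd_rfl
  have hprime : ∀ a b : MvPolynomial (Fin 2) k, (X 0 ^ s1 - C (μ ^ s1) * X 1 ^ s2) ∣ a * b →
      (X 0 ^ s1 - C (μ ^ s1) * X 1 ^ s2) ∣ a ∨ (X 0 ^ s1 - C (μ ^ s1) * X 1 ^ s2) ∣ b := by
    intro a b
    rw [hiff, hiff, hiff, map_mul]
    exact mul_eq_zero.mp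
  intro m
  induction m with
  | zero => exact fun _ => ⟨hn, hn'⟩
  | succ m ih =>
    intro hm
    obtain ⟨h, h'⟩ := ih (by omega)
    obtain ⟨d, rfl⟩ := Nat.exists_eq_add_of_le hm
    rw [show m + 1 + d - m = d + 1 by omega] at h h'
    rw [show m + 1 + d - (m + 1) = d by omega, Function.iterate_succ_apply']
    exact (pderiv (1 : Fin 2)).pow_dvd_and_not_pow_succ_dvd hH hprime hD h h'
end
end

section
/- Let ν ∈ 𝒱₀, let (f1,f2) be a component of an automorphism of Q which is non resonant with respect to ν (i.e. ν(f1) and ν(f2) are linearly independent over ℚ), and let ν0 be the monomial valuation on k[X,Y] with weights (ν(f1), ν(f2)). Then for every polynomial R ∈ k[X,Y], one has ν(R(f1,f2)) = ν0(R). -/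
noncomputable section

open MvPolynomial

/-- All monomials of `S` have `w`-weight at least `d`. -/
def WeightGE {σ R : Type*} [CommSemiring R] (w : σ → ℝ) (d : ℝ) (S : MvPolynomial σ R) : Prop :=
  ∀ I ∈ S.support, d ≤ Finsupp.weight w I

section WeightGE

variable {σ R : Type*} [CommRing R] {w : σ → ℝ} {d e : ℝ} {S T : MvPolynomial σ R}

lemma WeightGE.mono (h : WeightGE w d S) (hed : e ≤ d) : WeightGE w e S :=
  fun I hI => hed.trans (h I hI)

lemma WeightGE.add (hS : WeightGE w d S) (hT : WeightGE w d T) : WeightGE w d (S + T) := by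
  classical
  intro I hI
  rcases Finset.mem_union.1 (support_add hI) with h | h
  exacts [hS I h, hT I h]

lemma WeightGE.neg (hS : WeightGE w d S) : WeightGE w d (-S) := by
  intro I hI
  exact hS I (by simpa using hI)

lemma WeightGE.sub (hS : WeightGE w d S) (hT : WeightGE w d T) : WeightGE w d (S - T) := by
  rw [sub_eq_add_neg]
  exact hS.add hT.neg

lemma WeightGE.sum {ι : Type*} {s : Finset ι} {f : ι → MvPolynomial σ R}
    (h : ∀ i ∈ s, WeightGE w d (f i)) : WeightGE w d (∑ i ∈ s, f i) := by
  classical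
  intro I hI
  obtain ⟨i, hi, hI⟩ := Finset.mem_biUnion.1 (support_sum hI)
  exact h i hi I hI

lemma WeightGE.mul (hS : WeightGE w d S) (hT : WeightGE w e T) : WeightGE w (d + e) (S * T) := by
  classical
  intro I hI
  obtain ⟨J, hJ, K, hK, rfl⟩ := Finset.mem_add.1 (support_mul S T hI)
  rw [map_add]
  exact add_le_add (hS J hJ) (hT K hK)

lemma weightGE_C (r : R) : WeightGE w 0 (C r) := by
  classical
  intro I hI
  rw [mem_support_iff, coeff_C] at hI
  obtain rfl : 0 = I := by
    by_contra h
    simp [h] at hI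
  simp

lemma weightGE_X (i : σ) : WeightGE w (w i) (X i : MvPolynomial σ R) := by
  classical
  intro I hI
  rw [mem_support_iff, coeff_X] at hI
  obtain rfl : Finsupp.single i 1 = I := by
    by_contra h
    simp [h] at hI
  simp [Finsupp.weight_single]

/-- The lowest-weight component of a product is the product of the lowest-weight components. -/
lemma WeightGE.component_mul (hS : WeightGE w d S) (hT : WeightGE w e T) :
    weightedHomogeneousComponent w (d + e) (S * T) =
      weightedHomogeneousComponent w d S * weightedHomogeneousComponent w e T := by
  classical
  ext I
  have key : ∀ x ∈ Finset.HasAntidiagonal.antidiagonal I,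
      (if Finsupp.weight w x.1 = d then coeff x.1 S else 0) *
        (if Finsupp.weight w x.2 = e then coeff x.2 T else 0) =
      if Finsupp.weight w I = d + e then coeff x.1 S * coeff x.2 T else 0 := by
    rintro ⟨J, K⟩ hx
    obtain rfl := Finset.HasAntidiagonal.mem_antidiagonal.1 hx
    by_cases hJ : coeff J S = 0
    · simp [hJ]
    by_cases hK : coeff K T = 0
    · simp [hK]
    have h1 := hS J (mem_support_iff.2 hJ)
    have h2 := hT K (mem_support_iff.2 hK)
    rw [map_add]
    split_ifs <;> first | rfl | (exfalso; grind) | simp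
  simp only [coeff_weightedHomogeneousComponent, coeff_mul]
  rw [Finset.sum_congr rfl key]
  split_ifs <;> simp

lemma WeightGE.component_eq_zero (hS : WeightGE w d S) (h : e < d) :
    weightedHomogeneousComponent w e S = 0 :=
  weightedHomogeneousComponent_eq_zero' _ _ fun I hI => (h.trans_le (hS I hI)).ne'

/-- A nonzero polynomial has a weight, at which its component is nonzero. -/
lemma exists_weightGE (hne : S ≠ 0) :
    ∃ c, WeightGE w c S ∧ weightedHomogeneousComponent w c S ≠ 0 := by
  classical
  obtain ⟨I, hI, hmin⟩ := S.support.exists_min_image (Finsupp.weight w) (support_nonempty.2 hne)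
  refine ⟨_, hmin, fun h => ?_⟩
  have := congrArg (coeff I) h
  rw [coeff_weightedHomogeneousComponent, if_pos rfl, coeff_zero] at this
  exact mem_support_iff.1 hI this

/-- Cancelling the lowest-weight component strictly raises the weight of a nonzero polynomial. -/
lemma WeightGE.exists_lt (hS : WeightGE w d S) (h0 : weightedHomogeneousComponent w d S = 0)
    (hne : S ≠ 0) : ∃ c, d < c ∧ WeightGE w c S ∧ weightedHomogeneousComponent w c S ≠ 0 := by
  obtain ⟨c, hc, hc0⟩ := exists_weightGE (w := w) hne
  refine ⟨c, ?_, hc, hc0⟩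
  by_contra! hle
  rcases hle.eq_or_lt with rfl | hlt
  exacts [hc0 h0, hc0 (hS.component_eq_zero hlt)]

end WeightGE

/-- With negative weights, only finitely many monomials have weight at least `c`. -/
lemma finite_setOf_le_weight {σ : Type*} [Finite σ] {w : σ → ℝ} (hw : ∀ i, w i < 0) (c : ℝ) :
    {I : σ →₀ ℕ | c ≤ Finsupp.weight w I}.Finite := by
  classical
  have := Fintype.ofFinite σ
  refine (Set.finite_Iic (Finsupp.equivFunOnFinite.symm fun i => ⌈c / w i⌉₊)).subset ?_
  intro I hI i
  have hsum : Finsupp.weight w I ≤ (I i : ℝ) * w i := by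
    rw [Finsupp.weight_eq_sum, ← Finset.add_sum_erase _ _ (Finset.mem_univ i)]
    have : ∑ j ∈ Finset.univ.erase i, I j • w j ≤ 0 :=
      Finset.sum_nonpos fun j _ => by
        rw [nsmul_eq_mul]
        exact mul_nonpos_of_nonneg_of_nonpos (Nat.cast_nonneg _) (hw j).le
    rw [nsmul_eq_mul]
    linarith
  have h : (I i : ℝ) ≤ c / w i := by
    rw [le_div_iff_of_neg (hw i)]
    exact le_trans hI hsum
  exact_mod_cast h.trans (Nat.le_ceil _)

/-- `S` has weight exactly `d`, and its lowest-weight component is not divisible by `g`. -/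
def OptimalRep {σ R : Type*} [CommRing R] (w : σ → ℝ) (g : MvPolynomial σ R) (d : ℝ)
    (S : MvPolynomial σ R) : Prop :=
  WeightGE w d S ∧ ¬ g ∣ weightedHomogeneousComponent w d S

section OptimalRep

variable {σ R : Type*} [CommRing R] {w : σ → ℝ} {d e : ℝ} {g S T : MvPolynomial σ R}

lemma OptimalRep.mul (hg : Prime g) (hS : OptimalRep w g d S) (hT : OptimalRep w g e T) :
    OptimalRep w g (d + e) (S * T) := by
  refine ⟨hS.1.mul hT.1, ?_⟩
  rw [hS.1.component_mul hT.1]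
  exact hg.not_dvd_mul hS.2 hT.2

lemma optimalRep_C {K : Type*} [Field K] {g : MvPolynomial σ K} (hg : Prime g) {r : K}
    (hr : r ≠ 0) : OptimalRep w g 0 (C r) := by
  refine ⟨weightGE_C r, fun h => hg.not_isUnit (isUnit_of_dvd_unit h ?_)⟩
  rw [(isWeightedHomogeneous_C w r).weightedHomogeneousComponent_same]
  exact (isUnit_iff_ne_zero.2 hr).map C

lemma OptimalRep.pow {K : Type*} [Field K] {g S : MvPolynomial σ K} (hg : Prime g)
    (hS : OptimalRep w g d S) (n : ℕ) : OptimalRep w g (d * n) (S ^ n) := by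
  induction n with
  | zero => simpa using optimalRep_C (w := w) hg (one_ne_zero (α := K))
  | succ n ih =>
    rw [pow_succ, Nat.cast_succ, mul_add, mul_one]
    exact ih.mul hg hS

variable [IsDomain R] {G : MvPolynomial σ R}

/-- A polynomial with lowest-weight component not divisible by that of `G` has maximal weight
in its class modulo `G`. -/
lemma OptimalRep.weight_le (hS : OptimalRep w g d S) (hG : WeightGE w e G)
    (hg : weightedHomogeneousComponent w e G = g) (hg0 : g ≠ 0) (hdvd : G ∣ T - S) {c : ℝ}
    (hT : WeightGE w c T) : c ≤ d := by
  by_contra! hlt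
  obtain ⟨h, hh⟩ := hdvd
  have hST : weightedHomogeneousComponent w d S = - weightedHomogeneousComponent w d (G * h) := by
    rw [← hh, map_sub, hT.component_eq_zero hlt, zero_sub, neg_neg]
  apply hS.2
  rw [hST, dvd_neg]
  by_cases h0 : h = 0
  · simp [h0]
  obtain ⟨b, hb, hb0⟩ := exists_weightGE (w := w) h0
  have hge : WeightGE w d (G * h) := hh ▸ (hT.mono hlt.le).sub hS.1
  have hne : weightedHomogeneousComponent w (e + b) (G * h) ≠ 0 := by
    rw [hG.component_mul hb, hg]
    exact mul_ne_zero hg0 hb0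
  have hle : d ≤ e + b := by
    by_contra! h'
    exact hne (hge.component_eq_zero h')
  rcases hle.eq_or_lt with rfl | h'
  · rw [hG.component_mul hb, hg]
    exact dvd_mul_right _ _
  · rw [(hG.mul hb).component_eq_zero h']
    exact dvd_zero _

/-- Every nonzero class modulo `G` has an optimal representative. -/
lemma exists_optimalRep [Finite σ] (hw : ∀ i, w i < 0) (hG : WeightGE w e G)
    (hg : weightedHomogeneousComponent w e G = g) (hg0 : g ≠ 0) (hS : ¬ G ∣ S) :
    ∃ d T, G ∣ T - S ∧ OptimalRep w g d T := by
  have hrep : ∀ T, G ∣ T - S → T ≠ 0 := by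
    rintro T hT rfl
    exact hS (by simpa using hT)
  obtain ⟨c, hc, hc0⟩ := exists_weightGE (w := w) (hrep S (by simp))
  have hmem : ∀ (b : ℝ) (T : MvPolynomial σ R), weightedHomogeneousComponent w b T ≠ 0 →
      ∃ I : σ →₀ ℕ, Finsupp.weight w I = b := by
    intro b T hT
    by_contra! h
    exact hT (weightedHomogeneousComponent_eq_zero' _ _ fun I _ => h I)
  let V : Set ℝ := {b | c ≤ b ∧ ∃ T, G ∣ T - S ∧ WeightGE w b T ∧
    weightedHomogeneousComponent w b T ≠ 0}
  have hV : V.Finite := by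
    refine ((finite_setOf_le_weight hw c).image (Finsupp.weight w)).subset ?_
    rintro b ⟨hcb, T, -, -, hT⟩
    obtain ⟨I, rfl⟩ := hmem b T hT
    exact ⟨I, hcb, rfl⟩
  obtain ⟨d, ⟨hcd, T, hTS, hT, hT0⟩, hmax⟩ :=
    Set.exists_max_image V id hV ⟨c, le_rfl, S, by simp, hc, hc0⟩
  refine ⟨d, T, hTS, hT, ?_⟩
  rintro ⟨h, hh⟩
  have h0 : h ≠ 0 := by
    rintro rfl
    exact hT0 (by simpa using hh)
  obtain ⟨b, hb, hb0⟩ := exists_weightGE (w := w) h0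
  have hghom : IsWeightedHomogeneous w g e :=
    hg ▸ weightedHomogeneousComponent_isWeightedHomogeneous e G
  have hgself := hghom.weightedHomogeneousComponent_same
  have hgGE : WeightGE w e g := fun I hI => (hghom (mem_support_iff.1 hI)).ge
  have hprod : weightedHomogeneousComponent w (e + b) (g * h) = g *
      weightedHomogeneousComponent w b h := by
    rw [hgGE.component_mul hb, hgself]
  have hdeb : d = e + b := by
    by_contra hne
    refine mul_ne_zero hg0 hb0 (hprod.symm.trans ?_)
    rw [← hh]
    exact (weightedHomogeneousComponent_isWeightedHomogeneous _ _).weightedHomogeneousComponent_ne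
      _ (Ne.symm hne)
  subst hdeb
  have hcomp : weightedHomogeneousComponent w (e + b) (T - G * h) = 0 := by
    rw [map_sub, hG.component_mul hb, hg, ← hprod, ← hh,
      (weightedHomogeneousComponent_isWeightedHomogeneous _ _).weightedHomogeneousComponent_same,
      sub_self]
  have hdvd : G ∣ T - G * h - S := by
    rw [sub_right_comm]
    exact dvd_sub hTS (dvd_mul_right _ _)
  obtain ⟨c', hlt, hc', hc0'⟩ := (hT.sub (hG.mul hb)).exists_lt hcomp (hrep _ hdvd)
  exact absurd (hmax c' ⟨hcd.trans hlt.le, _, hdvd, hc', hc0'⟩) (not_le.2 hlt)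

end OptimalRep

lemma prime_qpoly (k : Type) [Field k] : Prime (qpoly k) := by
  have h3 : (3 : Fin 4) ∉ (-(X 1 * X 2) : MvPolynomial (Fin 4) k).vars := by
    classical
    intro h
    have := vars_mul _ _ ((vars_neg (X 1 * X 2 : MvPolynomial (Fin 4) k)) ▸ h)
    simp [vars_X] at this
  have h := irreducible_mul_X_add (X 0 : MvPolynomial (Fin 4) k) (-(X 1 * X 2)) 3 (X_ne_zero 0)
    (by simp [vars_X]) h3 (by
      rw [(X_prime (R := k) (i := (0 : Fin 4))).irreducible.isRelPrime_iff_not_dvd, dvd_neg]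
      refine (X_prime (R := k) (i := (0 : Fin 4))).not_dvd_mul ?_ ?_ <;> simp [X_dvd_X])
  rw [← sub_eq_add_neg] at h
  exact h.prime

/-- The translation of `k[x,y,z,t]` by `p`. -/
def translateHom (k : Type) [Field k] (p : Fin 4 → k) :
    MvPolynomial (Fin 4) k →ₐ[k] MvPolynomial (Fin 4) k :=
  aeval fun i => X i + C (p i)

lemma translateHom_neg (k : Type) [Field k] (p : Fin 4 → k) (S : MvPolynomial (Fin 4) k) :
    translateHom k p (translateHom k (-p) S) = S := by
  have : (translateHom k p).comp (translateHom k (-p)) = AlgHom.id k _ := by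
    ext i : 1
    simp [translateHom]
  exact DFunLike.congr_fun this S

lemma weightGE_translateHom_qpoly {k : Type} [Field k] {p : Fin 4 → k} {α : Fin 4 → ℝ}
    (hα : ∀ i, α i < 0) (hsum : α 0 + α 3 = α 1 + α 2) :
    WeightGE α (α 0 + α 3) (translateHom k p (qpoly k - 1)) ∧
      weightedHomogeneousComponent α (α 0 + α 3) (translateHom k p (qpoly k - 1)) = qpoly k := by
  have hX : ∀ i, WeightGE α (α i) (X i + C (p i)) := fun i =>
    (weightGE_X i).add ((weightGE_C _).mono (hα i).le)
  have hXc : ∀ i, weightedHomogeneousComponent α (α i) (X i + C (p i)) = X i := fun i => by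
    rw [map_add, (isWeightedHomogeneous_X k α i).weightedHomogeneousComponent_same,
      (weightGE_C _).component_eq_zero (hα i), add_zero]
  have hneg : α 0 + α 3 < 0 := add_neg (hα 0) (hα 3)
  have hone : WeightGE α 0 (1 : MvPolynomial (Fin 4) k) := weightGE_C 1
  have heq : translateHom k p (qpoly k - 1) =
      (X 0 + C (p 0)) * (X 3 + C (p 3)) - (X 1 + C (p 1)) * (X 2 + C (p 2)) - 1 := by
    simp [translateHom, qpoly]
  rw [heq]
  refine ⟨(((hX 0).mul (hX 3)).sub (hsum ▸ (hX 1).mul (hX 2))).sub (hone.mono hneg.le), ?_⟩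
  rw [map_sub, map_sub, (hX 0).component_mul (hX 3), hone.component_eq_zero hneg, sub_zero, hsum,
    (hX 1).component_mul (hX 2), hXc, hXc, hXc, hXc, qpoly]

lemma coe_le_mvalP_iff {k : Type} [Field k] {p : Fin 4 → k} {α : Fin 4 → ℝ} {d : ℝ}
    {S : MvPolynomial (Fin 4) k} :
    (d : WithTop ℝ) ≤ mvalP k p α S ↔ WeightGE α d (translateHom k p S) := by
  simp only [mvalP, Finset.le_inf_iff, WithTop.coe_le_coe, WeightGE, translateHom,
    Finsupp.weight_eq_sum, nsmul_eq_mul, mul_comm]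

lemma qmk_eq_iff {k : Type} [Field k] (p : Fin 4 → k) {S T : MvPolynomial (Fin 4) k} :
    qmk k S = qmk k T ↔ translateHom k p (qpoly k - 1) ∣ translateHom k p S - translateHom k p T := by
  rw [qmk, Ideal.Quotient.mk_eq_mk_iff_sub_mem, Ideal.mem_span_singleton, ← map_sub]
  refine ⟨map_dvd _, fun h => ?_⟩
  have := map_dvd (translateHom k (-p)) h
  have hp := translateHom_neg k (-p)
  rw [neg_neg] at hp
  rwa [hp, hp] at this

section nuSup

variable {k : Type} [Field k] {p : Fin 4 → k} {α : Fin 4 → ℝ}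

lemma nuSup_zero : nuSup k p α 0 = ⊤ := by
  refine top_le_iff.1 ((WithTop.isLUB_sSup' (s := {v : WithTop ℝ | ∃ R, qmk k R = 0 ∧
    mvalP k p α R = v}) ⟨_, 0, map_zero _, rfl⟩).1 ⟨0, map_zero _, ?_⟩)
  simp [mvalP]

/-- The value `ν(f)` is computed by any optimal representative of `f`. -/
lemma nuSup_eq_of_optimalRep (hα : ∀ i, α i < 0) (hsum : α 0 + α 3 = α 1 + α 2) {d : ℝ}
    {S : MvPolynomial (Fin 4) k} (hS : OptimalRep α (qpoly k) d (translateHom k p S)) :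
    nuSup k p α (qmk k S) = d := by
  obtain ⟨hG, hg⟩ := weightGE_translateHom_qpoly (p := p) hα hsum
  have hub : ∀ T, qmk k T = qmk k S → mvalP k p α T ≤ d := by
    intro T hT
    have hle : ∀ c : ℝ, (c : WithTop ℝ) ≤ mvalP k p α T → c ≤ d := fun c hc =>
      hS.weight_le hG hg (prime_qpoly k).ne_zero ((qmk_eq_iff p).1 hT) (coe_le_mvalP_iff.1 hc)
    cases hval : mvalP k p α T with
    | top => exact absurd (hle (d + 1) (hval ▸ le_top)) (by linarith)
    | coe c => exact WithTop.coe_le_coe.2 (hle c hval.ge)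
  have hlub := WithTop.isLUB_sSup' (s := {v : WithTop ℝ | ∃ R : MvPolynomial (Fin 4) k,
    qmk k R = qmk k S ∧ mvalP k p α R = v}) ⟨_, S, rfl, rfl⟩
  refine le_antisymm (hlub.2 ?_) ((coe_le_mvalP_iff.2 hS.1).trans (hlub.1 ⟨S, rfl, rfl⟩))
  rintro _ ⟨T, hT, rfl⟩
  exact hub T hT

lemma exists_optimalRep_of_nuSup_eq (hα : ∀ i, α i < 0) (hsum : α 0 + α 3 = α 1 + α 2) {d : ℝ}
    {f : QuadRing k} (hf : nuSup k p α f = d) :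
    ∃ S, qmk k S = f ∧ OptimalRep α (qpoly k) d (translateHom k p S) := by
  obtain ⟨hG, hg⟩ := weightGE_translateHom_qpoly (p := p) hα hsum
  obtain ⟨S, rfl⟩ : ∃ S, qmk k S = f := Ideal.Quotient.mk_surjective f
  have hS : ¬ translateHom k p (qpoly k - 1) ∣ translateHom k p S := by
    intro h
    have h0 : qmk k S = qmk k 0 := (qmk_eq_iff p).2 (by simpa using h)
    rw [h0, map_zero, nuSup_zero] at hf
    exact WithTop.top_ne_coe hf
  obtain ⟨c, T, hT, hopt⟩ := exists_optimalRep hα hG hg (prime_qpoly k).ne_zero hS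
  rw [← translateHom_neg k p T] at hT hopt
  have hTS := (qmk_eq_iff p).2 hT
  have hval := nuSup_eq_of_optimalRep hα hsum hopt
  rw [hTS, hf] at hval
  obtain rfl := WithTop.coe_injective hval
  exact ⟨_, hTS, hopt⟩

end nuSup

/-- Distinct exponents have distinct weights when the weights are linearly independent
over `ℚ`. -/
lemma weight_injective {a b : ℝ} (h : LinearIndependent ℚ ![a, b]) :
    Function.Injective (Finsupp.weight ![a, b] : (Fin 2 →₀ ℕ) → ℝ) := by
  intro I J hIJ
  rw [LinearIndependent.pair_iff] at h
  simp only [Finsupp.weight_eq_sum, Fin.sum_univ_two, nsmul_eq_mul, Matrix.cons_val_zero,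
    Matrix.cons_val_one] at hIJ
  obtain ⟨h0, h1⟩ := h ((I 0 : ℚ) - J 0) ((I 1 : ℚ) - J 1) (by
    simp only [Rat.smul_def]
    push_cast
    linarith)
  ext i
  fin_cases i
  · exact_mod_cast sub_eq_zero.1 h0
  · exact_mod_cast sub_eq_zero.1 h1

/-- Theorem 4.17 (ii): for every `ν ∈ 𝒱₀` and every component
`(f₁, f₂)` of an automorphism of `Q` which is non resonant with respect to `ν` (i.e.
`ν(f₁) = a` and `ν(f₂) = b` are linearly independent over `ℚ`), one has
`ν(R(f₁,f₂)) = ν₀(R)` for every polynomial `R ∈ k[X,Y]`, where `ν₀` is the monomial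
valuation with weights `(a, b)`. -/
theorem val_component_eq_monomialVal (k : Type) [Field k] [IsAlgClosed k] [CharZero k]
    (ν : QuadRing k → WithTop ℝ) (hν : ν ∈ V0 k)
    (f1 f2 : QuadRing k) (hcomp : IsComponent k f1 f2)
    (a b : ℝ) (ha : ν f1 = (a : WithTop ℝ)) (hb : ν f2 = (b : WithTop ℝ))
    (hres : LinearIndependent ℚ ![a, b]) :
    ∀ R : MvPolynomial (Fin 2) k,
      ν (MvPolynomial.aeval ![f1, f2] R) = mval2 k ![a, b] R := by
  classical
  intro R
  obtain ⟨p, α, hα, hsum, rfl⟩ := hν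
  rcases eq_or_ne R 0 with rfl | hR
  · rw [map_zero, nuSup_zero]
    simp [mval2]
  have hprime := prime_qpoly k
  obtain ⟨S, rfl, hS⟩ := exists_optimalRep_of_nuSup_eq hα hsum ha
  obtain ⟨T, rfl, hT⟩ := exists_optimalRep_of_nuSup_eq hα hsum hb
  set w : Fin 2 → ℝ := ![a, b]
  obtain ⟨I, hI, hmin⟩ := R.support.exists_min_image (Finsupp.weight w) (support_nonempty.2 hR)
  have hterm : ∀ J ∈ R.support, OptimalRep α (qpoly k) (Finsupp.weight w J)
      (C (coeff J R) * (translateHom k p S ^ J 0 * translateHom k p T ^ J 1)) := by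
    intro J hJ
    have h := (optimalRep_C (w := α) hprime (mem_support_iff.1 hJ)).mul hprime
      ((hS.pow hprime (J 0)).mul hprime (hT.pow hprime (J 1)))
    convert h using 1
    simp [Finsupp.weight_eq_sum, w, mul_comm]
  have hmap : aeval ![qmk k S, qmk k T] R = qmk k (aeval ![S, T] R) := by
    simp only [aeval_def, eval₂_eq', Fin.prod_univ_two, map_sum, map_mul, map_pow]
    rfl
  have htrans : translateHom k p (aeval ![S, T] R) = ∑ J ∈ R.support,
      C (coeff J R) * (translateHom k p S ^ J 0 * translateHom k p T ^ J 1) := by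
    simp only [aeval_def, eval₂_eq', Fin.prod_univ_two, map_sum, map_mul, map_pow, algebraMap_eq,
      algHom_C]
    rfl
  have hopt : OptimalRep α (qpoly k) (Finsupp.weight w I) (translateHom k p (aeval ![S, T] R)) := by
    rw [htrans]
    refine ⟨WeightGE.sum fun J hJ => (hterm J hJ).1.mono (hmin J hJ), ?_⟩
    rw [map_sum, Finset.sum_eq_single_of_mem I hI]
    · exact (hterm I hI).2
    · intro J hJ hne
      exact (hterm J hJ).1.component_eq_zero
        (lt_of_le_of_ne (hmin J hJ) fun h => hne (weight_injective hres h).symm)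
  have hwt : ∀ J : Fin 2 →₀ ℕ, ∑ i, w i * (J i : ℝ) = Finsupp.weight w J := by
    intro J
    simp [Finsupp.weight_eq_sum, mul_comm]
  rw [hmap, nuSup_eq_of_optimalRep hα hsum hopt, mval2]
  simp only [hwt]
  refine le_antisymm (Finset.le_inf fun J hJ => WithTop.coe_le_coe.2 (hmin J hJ))
    (Finset.inf_le hI)
end
end
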